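/- Let A be an irreducible k×k matrix with entries in {0,1}, let φ : Σ_A → ℝ be continuous with φ(x) > 0 for all x, and let η > 0. Then there exist an integer n ≥ 1, a real number τ > 0, and a function φ' : Σ_A → ℝ such that: (1) φ'(x) ≥ φ(x) for all x; (2) φ' is constant on central n-cylinders, i.e., φ'(x) depends only on the coordinates x_i for −⌊(n−1)/2⌋ ≤ i ≤ ⌊n/2⌋, and every value of φ' is a positive integer multiple of τ; (3) for every σ-invariant Borel probability measure μ on Σ_A one has | h_μ(σ)/∫φ' dμ − h_μ(σ)/∫φ dμ | < η. -/

import Mathlib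

open MeasureTheory Real Filter Set

/-- The shift map on the full shift `ℤ → S`. -/
def shiftMap {S : Type*} : (ℤ → S) → (ℤ → S) := fun x i => x (i + 1)

/-- The subshift of finite type determined by the 0-1 matrix `A : S → S → ℕ`. -/
def SFT {S : Type*} (A : S → S → ℕ) : Set (ℤ → S) :=
  {x | ∀ i : ℤ, A (x i) (x (i + 1)) = 1}

/-- `w : Fin n → S` is an admissible word for the 0-1 matrix `A`. -/
def IsAdmissible {S : Type*} (A : S → S → ℕ) {n : ℕ} (w : Fin n → S) : Prop :=
  ∀ (i : ℕ) (h : i + 1 < n), A (w ⟨i, Nat.lt_of_succ_lt h⟩) (w ⟨i + 1, h⟩) = 1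

/-- The shift map restricted to the SFT determined by `A`. -/
def restrictShift {S : Type*} (A : S → S → ℕ) (x : ↥(SFT A)) : ↥(SFT A) :=
  ⟨shiftMap x.1, fun i => x.2 (i + 1)⟩

open Classical in
/-- The `n`-block recoding matrix `A_n`, indexed by admissible words of length `n`:
`(b,b')`-entry is 1 iff the last `n-1` letters of `b` coincide with the first `n-1`
letters of `b'`. -/
noncomputable def blockMatrix {S : Type*} (A : S → S → ℕ) (n : ℕ) :
    {w : Fin n → S // IsAdmissible A w} → {w : Fin n → S // IsAdmissible A w} → ℕ :=
  fun b b' =>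
    if ∀ (p : ℕ) (h : p + 1 < n), b.1 ⟨p + 1, h⟩ = b'.1 ⟨p, Nat.lt_of_succ_lt h⟩ then 1 else 0

open Classical in
/-- `m`-th power of the matrix `A : S → S → ℕ`. -/
noncomputable def matPow {S : Type*} [Fintype S] (A : S → S → ℕ) : ℕ → S → S → ℕ
  | 0 => fun i j => if i = j then 1 else 0
  | (m + 1) => fun i j => ∑ r : S, matPow A m i r * A r j

/-- A nonnegative matrix is irreducible if for every `(i,j)` some power has positive
`(i,j)`-entry. -/
def IrreducibleMat {S : Type*} [Fintype S] (A : S → S → ℕ) : Prop :=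
  ∀ i j : S, ∃ m : ℕ, 1 ≤ m ∧ 0 < matPow A m i j

noncomputable instance wordsFintype {S : Type*} [Fintype S] (A : S → S → ℕ) (n : ℕ) :
    Fintype {w : Fin n → S // IsAdmissible A w} := Fintype.ofFinite _

/-- Shannon entropy of the partition of the full shift into cylinders of length `n`
(based at coordinates `0, …, n-1`). -/
noncomputable def blockH {k : ℕ} (μ : Measure (ℤ → Fin k)) (n : ℕ) : ℝ :=
  ∑ w : Fin n → Fin k,
    Real.negMulLog (μ {x | ∀ p : Fin n, x ((p : ℕ) : ℤ) = w p}).toReal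

/-- The measure-theoretic (Kolmogorov–Sinai) entropy of a shift-invariant measure `μ`
on the full shift: since the coordinate partition is generating and `blockH μ` is
subadditive, it equals `inf_{n ≥ 1} blockH μ n / n`. -/
noncomputable def mEntropy {k : ℕ} (μ : Measure (ℤ → Fin k)) : ℝ :=
  ⨅ n : ℕ, blockH μ (n + 1) / (n + 1)

/-- The number of admissible words of length `n` for `A`. -/
noncomputable def wordCount {k : ℕ} (A : Fin k → Fin k → ℕ) (n : ℕ) : ℕ :=
  Nat.card {w : Fin n → Fin k // IsAdmissible A w}

/-- The topological entropy of the SFT determined by an irreducible matrix `A`: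
the exponential growth rate of the number of admissible words, which by
subadditivity equals `inf_{n ≥ 1} (log wordCount n) / n`. -/
noncomputable def topEnt {k : ℕ} (A : Fin k → Fin k → ℕ) : ℝ :=
  ⨅ n : ℕ, Real.log (wordCount A (n + 1)) / (n + 1)

/-- `μ` is a `σ`-invariant Borel probability measure carried by the SFT `Σ_A`. -/
def InvProbOn {k : ℕ} (A : Fin k → Fin k → ℕ) (μ : Measure (ℤ → Fin k)) : Prop :=
  IsProbabilityMeasure μ ∧ MeasurePreserving shiftMap μ μ ∧ μ (SFT A) = 1

lemma isClosed_SFT {S : Type*} [TopologicalSpace S] [DiscreteTopology S] (A : S → S → ℕ) :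
    IsClosed (SFT A) := by
  have h : SFT A = ⋂ i : ℤ, (fun x : ℤ → S => (x i, x (i + 1))) ⁻¹' {p | A p.1 p.2 = 1} := by
    ext x
    simp [SFT]
  rw [h]
  exact isClosed_iInter fun i => (isClosed_discrete _).preimage (by fun_prop)

/-- A continuous function on a compact set of sequences over a discrete alphabet varies little
on sufficiently long central cylinders. -/
lemma exists_central_cylinder_dist_lt {S : Type*} [TopologicalSpace S] [DiscreteTopology S]
    {K : Set (ℤ → S)} (hK : IsCompact K) {φ : (ℤ → S) → ℝ} (hφ : ContinuousOn φ K)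
    {ε : ℝ} (hε : 0 < ε) :
    ∃ N : ℕ, ∀ x ∈ K, ∀ y ∈ K, (∀ i ∈ Finset.Icc (-(N : ℤ)) N, x i = y i) →
      |φ x - φ y| < ε := by
  have hloc : ∀ x ∈ K, ∃ I : Set ℤ, I.Finite ∧
      ∀ y ∈ K, (∀ i ∈ I, y i = x i) → |φ y - φ x| < ε / 2 := by
    intro x hx
    have h1 := Metric.continuousWithinAt_iff'.1 (hφ x hx) (ε / 2) (half_pos hε)
    rw [eventually_nhdsWithin_iff, nhds_pi, Filter.Eventually, Filter.mem_pi] at h1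
    obtain ⟨I, hI, t, ht, hsub⟩ := h1
    refine ⟨I, hI, fun y hy hyx => ?_⟩
    have := hsub (show y ∈ I.pi t from fun i hi => by
      rw [hyx i hi]; exact mem_of_mem_nhds (ht i)) hy
    simpa [Real.dist_eq] using this
  choose! I hI hIφ using hloc
  obtain ⟨t, htK, ht⟩ := hK.elim_nhds_subcover (fun x => {y | ∀ i ∈ I x, x i = y i}) (by
    intro x hx
    have : {y : ℤ → S | ∀ i ∈ I x, x i = y i} = (I x).pi fun i => {x i} := by
      ext y
      simp [Set.mem_pi, eq_comm]
    rw [this]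
    exact set_pi_mem_nhds (hI x hx) fun i _ => by simp)
  have hfin : (⋃ z ∈ t, I z).Finite := t.finite_toSet.biUnion fun z hz => hI z (htK z hz)
  obtain ⟨N, hN⟩ : ∃ N : ℕ, ∀ i ∈ ⋃ z ∈ t, I z, i.natAbs ≤ N := by
    obtain ⟨N, hN⟩ := (hfin.image Int.natAbs).bddAbove
    exact ⟨N, fun i hi => hN ⟨i, hi, rfl⟩⟩
  refine ⟨N, fun x hx y hy hxy => ?_⟩
  obtain ⟨z, hz, hxz⟩ := Set.mem_iUnion₂.1 (ht hx)
  have hx' := hIφ z (htK z hz) x hx fun i hi => (hxz i hi).symm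
  have hy' := hIφ z (htK z hz) y hy fun i hi => by
    have := hN i (Set.mem_biUnion hz hi)
    rw [← hxy i (Finset.mem_Icc.2 (by omega))]
    exact (hxz i hi).symm
  rw [abs_lt] at *
  constructor <;> linarith

lemma blockH_nonneg {k : ℕ} (μ : Measure (ℤ → Fin k)) [IsProbabilityMeasure μ] (n : ℕ) :
    0 ≤ blockH μ n :=
  Finset.sum_nonneg fun _ _ => Real.negMulLog_nonneg ENNReal.toReal_nonneg measureReal_le_one

lemma mEntropy_nonneg {k : ℕ} (μ : Measure (ℤ → Fin k)) [IsProbabilityMeasure μ] :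
    0 ≤ mEntropy μ :=
  Real.iInf_nonneg fun n => div_nonneg (blockH_nonneg μ _) (by positivity)

lemma mEntropy_le {k : ℕ} (μ : Measure (ℤ → Fin k)) [IsProbabilityMeasure μ] :
    mEntropy μ ≤ k := by
  have hbdd : BddBelow (Set.range fun n : ℕ => blockH μ (n + 1) / (n + 1)) :=
    ⟨0, by rintro _ ⟨n, rfl⟩; exact div_nonneg (blockH_nonneg μ _) (by positivity)⟩
  refine (ciInf_le hbdd 0).trans ?_
  have hle : ∀ x : ℝ, 0 ≤ x → x ≤ 1 → Real.negMulLog x ≤ 1 := by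
    intro x h0 h1
    rcases h0.eq_or_lt with rfl | h0
    · simp
    · have h2 := Real.one_sub_inv_le_log_of_pos h0
      have h3 := mul_le_mul_of_nonneg_left h2 h0.le
      rw [mul_sub, mul_inv_cancel₀ h0.ne'] at h3
      rw [Real.negMulLog]
      linarith
  have : blockH μ 1 ≤ ∑ _w : Fin 1 → Fin k, (1 : ℝ) :=
    Finset.sum_le_sum fun _ _ => hle _ ENNReal.toReal_nonneg measureReal_le_one
  simpa using this

/-- A continuous function on a compact set of sequences is approximated from above, within `3 * ε`,
by a locally constant function with values in `εℤ`. -/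
lemma exists_locallyConstant_approx {S : Type*} [TopologicalSpace S] [DiscreteTopology S]
    {K : Set (ℤ → S)} (hK : IsCompact K) {φ : (ℤ → S) → ℝ} (hφ : ContinuousOn φ K)
    (hpos : ∀ x ∈ K, 0 < φ x) {ε : ℝ} (hε : 0 < ε) :
    ∃ N : ℕ, ∃ F : (Finset.Icc (-(N : ℤ)) N → S) → ℝ, ∀ x ∈ K,
      φ x ≤ F (fun i => x i) ∧ F (fun i => x i) ≤ φ x + 3 * ε ∧
        ∃ l : ℕ, 0 < l ∧ F (fun i => x i) = l * ε := by
  obtain ⟨N, hN⟩ := exists_central_cylinder_dist_lt hK hφ hε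
  rcases K.eq_empty_or_nonempty with rfl | ⟨x₀, -⟩
  · exact ⟨N, fun _ => 0, by simp⟩
  have : Nonempty (ℤ → S) := ⟨x₀⟩
  let r : (Finset.Icc (-(N : ℤ)) N → S) → ℤ → S := fun w =>
    Classical.epsilon fun y => y ∈ K ∧ ∀ i, y i.1 = w i
  refine ⟨N, fun w => ⌈(φ (r w) + ε) / ε⌉₊ * ε, fun x hx => ?_⟩
  set y := r fun i => x i
  have hyx : y ∈ K ∧ ∀ i : Finset.Icc (-(N : ℤ)) N, y i.1 = x i :=
    Classical.epsilon_spec (p := fun y => y ∈ K ∧ ∀ i : Finset.Icc (-(N : ℤ)) N, y i.1 = x i)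
      ⟨x, hx, fun _ => rfl⟩
  have hd := abs_lt.1 (hN y hyx.1 x hx fun i hi => hyx.2 ⟨i, hi⟩)
  have hq : 0 < (φ y + ε) / ε := div_pos (add_pos (hpos y hyx.1) hε) hε
  have h1 := Nat.le_ceil ((φ y + ε) / ε)
  have h2 := (Nat.ceil_lt_add_one hq.le).le
  have h3 : (φ y + ε) / ε * ε = φ y + ε := div_mul_cancel₀ _ hε.ne'
  have h4 := mul_le_mul_of_nonneg_right h1 hε.le
  have h5 := mul_le_mul_of_nonneg_right h2 hε.le
  exact ⟨by linarith, by linarith, _, Nat.ceil_pos.2 hq, rfl⟩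

/-- Let `A` be an irreducible `k × k` 0-1 matrix, `φ : Σ_A → ℝ`
continuous and strictly positive, and `η > 0`. Then there are `n ≥ 1`, `τ > 0` and
`φ' : Σ_A → ℝ` such that: (1) `φ' ≥ φ` on `Σ_A`; (2) `φ'` is constant on central
`n`-cylinders and all its values on `Σ_A` are positive integer multiples of `τ`;
(3) for every shift-invariant Borel probability measure `μ` carried by `Σ_A`,
`| h_μ(σ)/∫ φ' dμ − h_μ(σ)/∫ φ dμ | < η`. -/
theorem stmt9 {k : ℕ} (hk : 1 ≤ k) (A : Fin k → Fin k → ℕ)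
    (h01 : ∀ i j, A i j = 0 ∨ A i j = 1) (hirr : IrreducibleMat A)
    (φ : (ℤ → Fin k) → ℝ) (hφcont : ContinuousOn φ (SFT A))
    (hφpos : ∀ x ∈ SFT A, 0 < φ x)
    (η : ℝ) (hη : 0 < η) :
    ∃ n : ℕ, 1 ≤ n ∧ ∃ τ : ℝ, 0 < τ ∧ ∃ φ' : (ℤ → Fin k) → ℝ,
      (∀ x ∈ SFT A, φ x ≤ φ' x) ∧
      (∀ x ∈ SFT A, ∀ y ∈ SFT A,
        (∀ i ∈ Set.Icc (-(((n - 1) / 2 : ℕ) : ℤ)) (((n / 2 : ℕ) : ℤ)), x i = y i) →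
        φ' x = φ' y) ∧
      (∀ x ∈ SFT A, ∃ l : ℕ, 0 < l ∧ φ' x = l * τ) ∧
      (∀ μ : Measure (ℤ → Fin k), InvProbOn A μ →
        |mEntropy μ / (∫ x in SFT A, φ' x ∂μ) - mEntropy μ / (∫ x in SFT A, φ x ∂μ)| < η) := by
  have hclosed := isClosed_SFT A
  have hK : IsCompact (SFT A) := hclosed.isCompact
  obtain ⟨m, hm, hmφ⟩ : ∃ m : ℝ, 0 < m ∧ ∀ x ∈ SFT A, m ≤ φ x := by
    rcases (SFT A).eq_empty_or_nonempty with h | h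
    · exact ⟨1, one_pos, by simp [h]⟩
    · obtain ⟨x, hx, hmin⟩ := hK.exists_isMinOn h hφcont
      exact ⟨φ x, hφpos x hx, fun y hy => hmin hy⟩
  set ε : ℝ := η * m ^ 2 / (3 * (k + 1)) with hεdef
  have hε : 0 < ε := by positivity
  obtain ⟨N, F, hF⟩ := exists_locallyConstant_approx hK hφcont hφpos hε
  refine ⟨2 * N + 1, by omega, ε, hε, fun x => F fun i => x i, fun x hx => (hF x hx).1,
    fun x _ y _ hxy => ?_, fun x hx => (hF x hx).2.2, fun μ hμ => ?_⟩
  · refine congrArg F (funext fun i => hxy i ?_)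
    have := Finset.mem_Icc.1 i.2
    rw [Set.mem_Icc]
    omega
  obtain ⟨hprob, -, hμK⟩ := hμ
  have hint : IntegrableOn φ (SFT A) μ := hφcont.integrableOn_compact hK
  have hint' : IntegrableOn (fun x : ℤ → Fin k => F fun i => x i) (SFT A) μ := by
    refine ContinuousOn.integrableOn_compact hK (Continuous.continuousOn ?_)
    exact (continuous_of_discreteTopology (f := F)).comp (by fun_prop)
  have hconst : ∀ c : ℝ, ∫ _ in SFT A, c ∂μ = c := fun c => by simp [Measure.real, hμK]
  have hc : ∀ c : ℝ, IntegrableOn (fun _ => c) (SFT A) μ := fun c => integrable_const c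
  have ha : m ≤ ∫ x in SFT A, φ x ∂μ := by
    rw [← hconst m]
    exact setIntegral_mono_on (hc m) hint hclosed.measurableSet hmφ
  have hab : ∫ x in SFT A, φ x ∂μ ≤ ∫ x in SFT A, F (fun i => x i) ∂μ :=
    setIntegral_mono_on hint hint' hclosed.measurableSet fun x hx => (hF x hx).1
  have hba : ∫ x in SFT A, F (fun i => x i) ∂μ ≤ (∫ x in SFT A, φ x ∂μ) + 3 * ε := by
    rw [← hconst (3 * ε), ← integral_add hint (hc _)]
    exact setIntegral_mono_on hint' (hint.add (hc _)) hclosed.measurableSet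
      fun x hx => (hF x hx).2.1
  have h0 := mEntropy_nonneg μ
  have h1 := mEntropy_le μ
  dsimp only
  generalize ∫ x in SFT A, φ x ∂μ = a at *
  generalize ∫ x in SFT A, F (fun i => x i) ∂μ = b at *
  generalize mEntropy μ = h at *
  have ha0 : 0 < a := hm.trans_le ha
  have hb0 : 0 < b := ha0.trans_le hab
  have heq : h / b - h / a = -(h * (b - a) / (a * b)) := by
    field_simp
    ring
  rw [heq, abs_neg, abs_of_nonneg (by
    have := sub_nonneg.2 hab
    positivity), div_lt_iff₀ (by positivity)]
  have hε_mul : 3 * ε * (k + 1) = η * m ^ 2 := by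
    rw [hεdef]
    field_simp
  calc h * (b - a) ≤ k * (3 * ε) :=
        mul_le_mul h1 (by linarith) (by linarith) (by positivity)
    _ < 3 * ε * (k + 1) := by linarith
    _ = η * (m * m) := by rw [hε_mul, sq]
    _ ≤ η * (a * b) := by
        have := ha.trans hab
        gcongr
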